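/- Let E be a real vector space, let A : ℝ^p → ℝ^p and L : E → ℝ^p be linear maps, and consider triples s = (x, y, w) of functions x : [0,1] → ℝ^p, y : [0,1] → ℝ^p, w : [0,1] → E satisfying the constraint y(u) = A(x(u)) + L(w(u)) for all u ∈ [0,1]; write S for the set of such triples. For η ∈ E define the transformation g_η(x, y, w) := (x, u ↦ y(u) − u·L(η), u ↦ w(u) − u·η), and for a function v on [0,1] define its bridge B^v(u) := v(u) − u·v(1). Then: (i) g_η maps S into S and {g_η : η ∈ E} forms a group under composition (g_η ∘ g_{η'} = g_{η+η'}); (ii) the map M(x, y, w) := (x, B^y, B^w) is invariant, i.e. M(g_η(s)) = M(s) for all η ∈ E and s ∈ S; and (iii) M is a maximal invariant on S: if s, s' ∈ S satisfy M(s) = M(s'), then there exists η ∈ E with s' = g_η(s) (namely η = w(1) − w'(1)). -/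

import Mathlib

open unitInterval

/-- A triple `(x, y, w)` of paths on `[0,1]`: `x, y` are `ℝ^p`-valued and `w` is `E`-valued. -/
noncomputable def PathTriple (p : ℕ) (E : Type*) : Type _ :=
  (unitInterval → (Fin p → ℝ)) × (unitInterval → (Fin p → ℝ)) × (unitInterval → E)

/-- The constraint set `S`: triples satisfying `y(u) = A(x(u)) + L(w(u))` for all `u`. -/
noncomputable def constraintSet {p : ℕ} {E : Type*} [AddCommGroup E] [Module ℝ E]
    (A : (Fin p → ℝ) →ₗ[ℝ] (Fin p → ℝ)) (L : E →ₗ[ℝ] (Fin p → ℝ)) :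
    Set (PathTriple p E) :=
  {s | ∀ u : unitInterval, s.2.1 u = A (s.1 u) + L (s.2.2 u)}

/-- The drift-shift transformation `g_η(x, y, w) = (x, y − u·L η, w − u·η)`. -/
noncomputable def driftShift {p : ℕ} {E : Type*} [AddCommGroup E] [Module ℝ E]
    (L : E →ₗ[ℝ] (Fin p → ℝ)) (η : E) (s : PathTriple p E) : PathTriple p E :=
  (s.1, fun u => s.2.1 u - (u : ℝ) • L η, fun u => s.2.2 u - (u : ℝ) • η)

/-- The bridge of a path: `B^v(u) = v(u) − u·v(1)`. -/
noncomputable def pathBridge {V : Type*} [AddCommGroup V] [Module ℝ V]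
    (v : unitInterval → V) : unitInterval → V :=
  fun u => v u - (u : ℝ) • v 1

/-- The candidate maximal invariant `M(x, y, w) = (x, B^y, B^w)`. -/
noncomputable def bridgeInvariant {p : ℕ} {E : Type*} [AddCommGroup E] [Module ℝ E]
    (s : PathTriple p E) : PathTriple p E :=
  (s.1, pathBridge s.2.1, pathBridge s.2.2)

/-- The bridge does not see a linear drift. -/
theorem pathBridge_sub_drift {V : Type*} [AddCommGroup V] [Module ℝ V]
    (v : unitInterval → V) (a : V) :
    pathBridge (fun u => v u - (u : ℝ) • a) = pathBridge v := by
  funext u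
  simp only [pathBridge, Set.Icc.coe_one]
  module

/-- Two paths with the same bridge differ by a linear drift. -/
theorem eq_sub_drift_of_pathBridge_eq {V : Type*} [AddCommGroup V] [Module ℝ V]
    {v v' : unitInterval → V} (h : pathBridge v = pathBridge v') (u : unitInterval) :
    v' u = v u - (u : ℝ) • (v 1 - v' 1) := by
  have hu : v u - (u : ℝ) • v 1 = v' u - (u : ℝ) • v' 1 := congrFun h u
  rw [smul_sub, ← sub_add, hu, sub_add_cancel]

theorem driftShift_mem_constraintSet {p : ℕ} {E : Type*} [AddCommGroup E] [Module ℝ E]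
    (A : (Fin p → ℝ) →ₗ[ℝ] (Fin p → ℝ)) (L : E →ₗ[ℝ] (Fin p → ℝ)) (η : E)
    {s : PathTriple p E} (hs : s ∈ constraintSet A L) :
    driftShift L η s ∈ constraintSet A L := by
  intro u
  have hu : s.2.1 u = A (s.1 u) + L (s.2.2 u) := hs u
  simp only [driftShift, hu, map_sub, map_smul]
  abel

theorem driftShift_driftShift {p : ℕ} {E : Type*} [AddCommGroup E] [Module ℝ E]
    (L : E →ₗ[ℝ] (Fin p → ℝ)) (η η' : E) (s : PathTriple p E) :
    driftShift L η (driftShift L η' s) = driftShift L (η + η') s := by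
  refine Prod.ext rfl (Prod.ext (funext fun u => ?_) (funext fun u => ?_)) <;>
    simp only [driftShift, map_add] <;> module

/-- A triple in the constraint set is determined by its first and third components, so equality
of the drift-shifted third components suffices. -/
theorem eq_driftShift_of_constraintSet {p : ℕ} {E : Type*} [AddCommGroup E] [Module ℝ E]
    {A : (Fin p → ℝ) →ₗ[ℝ] (Fin p → ℝ)} {L : E →ₗ[ℝ] (Fin p → ℝ)} {η : E}
    {s s' : PathTriple p E} (hs : s ∈ constraintSet A L) (hs' : s' ∈ constraintSet A L)
    (hx : s.1 = s'.1) (hw : ∀ u, s'.2.2 u = s.2.2 u - (u : ℝ) • η) :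
    s' = driftShift L η s := by
  refine Prod.ext hx.symm (Prod.ext (funext fun u => ?_) (funext hw))
  have hu : s.2.1 u = A (s.1 u) + L (s.2.2 u) := hs u
  have hu' : s'.2.1 u = A (s'.1 u) + L (s'.2.2 u) := hs' u
  simp only [driftShift]
  rw [hu', hu, hw, hx, map_sub, map_smul, add_sub_assoc]

/-- Theorem 1, deterministic core: maximal invariance of the bridge map.
(i) each `g_η` maps `S` into `S` and `g_η ∘ g_{η'} = g_{η+η'}` (so the `g_η` form a group);
(ii) `M(x,y,w) = (x, B^y, B^w)` is invariant under every `g_η`;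
(iii) `M` is a maximal invariant on `S`: if `M(s) = M(s')` for `s, s' ∈ S`, then `s' = g_η(s)`
for some `η`. -/
theorem bridge_is_maximal_invariant {p : ℕ} {E : Type*} [AddCommGroup E] [Module ℝ E]
    (A : (Fin p → ℝ) →ₗ[ℝ] (Fin p → ℝ)) (L : E →ₗ[ℝ] (Fin p → ℝ)) :
    (∀ (η : E) (s : PathTriple p E),
      s ∈ constraintSet A L → driftShift L η s ∈ constraintSet A L) ∧
    (∀ (η η' : E) (s : PathTriple p E),
      driftShift L η (driftShift L η' s) = driftShift L (η + η') s) ∧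
    (∀ (η : E) (s : PathTriple p E),
      bridgeInvariant (driftShift L η s) = bridgeInvariant s) ∧
    (∀ s s' : PathTriple p E,
      s ∈ constraintSet A L → s' ∈ constraintSet A L →
      bridgeInvariant s = bridgeInvariant s' → ∃ η : E, s' = driftShift L η s) := by
  refine ⟨fun η s => driftShift_mem_constraintSet A L η, driftShift_driftShift L,
    fun η s => ?_, fun s s' hs hs' h => ?_⟩
  · exact Prod.ext rfl
      (Prod.ext (pathBridge_sub_drift s.2.1 (L η)) (pathBridge_sub_drift s.2.2 η))
  · obtain ⟨hx, h⟩ := Prod.ext_iff.mp h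
    exact ⟨s.2.2 1 - s'.2.2 1, eq_driftShift_of_constraintSet hs hs' hx
      (eq_sub_drift_of_pathBridge_eq (Prod.ext_iff.mp h).2)⟩
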